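/- Let Y = (0,1)², N a positive integer, h = 1/N, and let 𝒯_h be the uniform triangulation of Y consisting of the 2N² triangles obtained by dividing each square [ih,(i+1)h] × [jh,(j+1)h] (0 ≤ i,j ≤ N−1) along the diagonal from (ih,jh) to ((i+1)h,(j+1)h). For 0 < δ ≤ h and K ∈ 𝒯_h let K_δ be the image of K under the homothety with center the barycenter x_K of K and ratio δ/h. For (i,j) ∈ ℤ² let φ^{ij}(x) = max(0, 1 − max(|x₁/h − i|, |x₂/h − j|, |(x₁ − x₂)/h − (i − j)|)). For an integrable Q : Y → ℝ and any indices ij, kl ∈ ℤ² define A^Q_{ij,kl} = Σ_{K ∈ 𝒯_h} (|K|/|K_δ|) ∫_{K_δ} (∇φ^{ij} · ∇φ^{kl} + Q φ^{ij} φ^{kl}) dx, and define d^Q_{ij} = Σ_{K ∈ 𝒯_h} (|K|/|K_δ|) ∫_{K_δ} Q φ^{ij} dx. Let d^±_1(i,j) = (i±1,j), d^±_2(i,j) = (i,j±1), d^±_3(i,j) = (i±1,j±1). Then for every interior node ij with 1 ≤ i, j ≤ N−1, A^Q_{ij,ij} = d^Q_{ij} − Σ_{s=1}^{3} (A^Q_{ij,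 d^+_s ij} + A^Q_{ij, d^-_s ij}). -/

import Mathlib

noncomputable section
open MeasureTheory

/-- Closed triangle of the uniform triangulation of the unit square: for
`0 ≤ i, j ≤ N−1`, `tri h i j true` is the lower triangle with vertices
`(ih, jh), ((i+1)h, jh), ((i+1)h, (j+1)h)` and `tri h i j false` the upper triangle
with vertices `(ih, jh), (ih, (j+1)h), ((i+1)h, (j+1)h)`. -/
def tri (h : ℝ) (i j : ℕ) (lower : Bool) : Set (ℝ × ℝ) :=
  if lower then
    convexHull ℝ {((i * h, j * h) : ℝ × ℝ), ((i + 1) * h, j * h), ((i + 1) * h, (j + 1) * h)}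
  else
    convexHull ℝ {((i * h, j * h) : ℝ × ℝ), (i * h, (j + 1) * h), ((i + 1) * h, (j + 1) * h)}

/-- The barycenter of the triangle `tri h i j lower`. -/
def bary (h : ℝ) (i j : ℕ) (lower : Bool) : ℝ × ℝ :=
  if lower then ((3 * i + 2) / 3 * h, (3 * j + 1) / 3 * h)
  else ((3 * i + 1) / 3 * h, (3 * j + 2) / 3 * h)

/-- The patch `K_δ`: the image of the triangle `K = tri h i j lower` under the
homothety with center the barycenter of `K` and ratio `δ/h`. -/
def patch (h δ : ℝ) (i j : ℕ) (lower : Bool) : Set (ℝ × ℝ) :=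
  (AffineMap.homothety (bary h i j lower) (δ / h)) '' (tri h i j lower)

/-- The P1 hat (nodal basis) function at the node `(i h, j h)`. -/
def hat (h : ℝ) (p : ℤ × ℤ) (x : ℝ × ℝ) : ℝ :=
  max 0 (1 - max |x.1 / h - (p.1 : ℝ)|
    (max |x.2 / h - (p.2 : ℝ)| |(x.1 - x.2) / h - ((p.1 : ℝ) - (p.2 : ℝ))|))

/-- Dot product of the gradients of two functions (via the Fréchet derivative; for
piecewise affine functions this is the piecewise constant gradient a.e.). -/
def gradDot (f g : ℝ × ℝ → ℝ) (x : ℝ × ℝ) : ℝ :=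
  fderiv ℝ f x (1, 0) * fderiv ℝ g x (1, 0) + fderiv ℝ f x (0, 1) * fderiv ℝ g x (0, 1)

/-- The HMM stiffness matrix with potential `Q`:
`A^Q_{p,r} = Σ_{K ∈ 𝒯_h} (|K|/|K_δ|) ∫_{K_δ} (∇φ^p·∇φ^r + Q φ^p φ^r)`. -/
def stiff (h δ : ℝ) (N : ℕ) (Q : ℝ × ℝ → ℝ) (p r : ℤ × ℤ) : ℝ :=
  ∑ t : Fin N × Fin N × Bool,
    (volume (tri h t.1 t.2.1 t.2.2)).toReal / (volume (patch h δ t.1 t.2.1 t.2.2)).toReal *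
      ∫ x in patch h δ t.1 t.2.1 t.2.2,
        (gradDot (hat h p) (hat h r) x + Q x * hat h p x * hat h r x)

/-- `d^Q_{p} = Σ_{K ∈ 𝒯_h} (|K|/|K_δ|) ∫_{K_δ} Q φ^p`. -/
def dQvec (h δ : ℝ) (N : ℕ) (Q : ℝ × ℝ → ℝ) (p : ℤ × ℤ) : ℝ :=
  ∑ t : Fin N × Fin N × Bool,
    (volume (tri h t.1 t.2.1 t.2.2)).toReal / (volume (patch h δ t.1 t.2.1 t.2.2)).toReal *
      ∫ x in patch h δ t.1 t.2.1 t.2.2, Q x * hat h p x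

/-- Forward neighbor maps `d^+_s`, `s = 1, 2, 3` (horizontal, vertical, diagonal). -/
def dp (s : Fin 3) (p : ℤ × ℤ) : ℤ × ℤ :=
  if s = 0 then (p.1 + 1, p.2) else if s = 1 then (p.1, p.2 + 1) else (p.1 + 1, p.2 + 1)

/-- Backward neighbor maps `d^-_s`, `s = 1, 2, 3`. -/
def dm (s : Fin 3) (p : ℤ × ℤ) : ℤ × ℤ :=
  if s = 0 then (p.1 - 1, p.2) else if s = 1 then (p.1, p.2 - 1) else (p.1 - 1, p.2 - 1)

/-- The unit square `Y = (0,1)²`. -/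
def Ysq : Set (ℝ × ℝ) := Set.Ioo (0 : ℝ) 1 ×ˢ Set.Ioo (0 : ℝ) 1

/-- The hat function of the reference grid `ℤ²` centred at the origin. -/
def refHat (u v : ℝ) : ℝ :=
  max 0 (1 - max |u| (max |v| |u - v|))

lemma hat_eq_refHat (h : ℝ) (p : ℤ × ℤ) (x : ℝ × ℝ) :
    hat h p x = refHat (x.1 / h - p.1) (x.2 / h - p.2) := by
  unfold hat refHat
  congr 5
  ring

lemma refHat_eq_zero {u v : ℝ} (H : 1 ≤ |u| ∨ 1 ≤ |v| ∨ 1 ≤ |u - v|) : refHat u v = 0 := by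
  refine max_eq_left ?_
  rw [sub_nonpos]
  simpa [le_max_iff] using H

lemma refHat_eq_of {u v m : ℝ} (hm : max |u| (max |v| |u - v|) = m) (h1 : m ≤ 1) :
    refHat u v = 1 - m := by
  subst hm
  exact max_eq_right (by linarith)

lemma refHat_swap (u v : ℝ) : refHat v u = refHat u v := by
  unfold refHat
  rw [abs_sub_comm v u, max_left_comm]

lemma refHat_neg (u v : ℝ) : refHat (-u) (-v) = refHat u v := by
  unfold refHat
  rw [abs_neg, abs_neg, show -u - -v = -(u - v) by ring, abs_neg]

lemma refHat_of_nonneg_of_le {u v : ℝ} (hv : 0 ≤ v) (hvu : v ≤ u) (hu : u ≤ 1) :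
    refHat u v = 1 - u := by
  refine refHat_eq_of ?_ hu
  rw [abs_of_nonneg (hv.trans hvu), abs_of_nonneg hv, abs_of_nonneg (sub_nonneg.2 hvu)]
  exact max_eq_left (max_le hvu (by linarith))

lemma refHat_of_nonneg_of_nonpos {u v : ℝ} (hu : 0 ≤ u) (hv : v ≤ 0) (huv : u - v ≤ 1) :
    refHat u v = 1 - (u - v) := by
  refine refHat_eq_of ?_ huv
  rw [abs_of_nonneg hu, abs_of_nonpos hv, abs_of_nonneg (by linarith)]
  rw [max_eq_right (show -v ≤ u - v by linarith), max_eq_right (by linarith)]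

/-- Sum of the reference hat functions at the origin and at its six neighbours. -/
def starSum (u v : ℝ) : ℝ :=
  refHat u v + (refHat (u - 1) v + refHat (u + 1) v) + (refHat u (v - 1) + refHat u (v + 1)) +
    (refHat (u - 1) (v - 1) + refHat (u + 1) (v + 1))

lemma starSum_swap (u v : ℝ) : starSum v u = starSum u v := by
  unfold starSum
  rw [refHat_swap u v, refHat_swap u (v - 1), refHat_swap u (v + 1), refHat_swap (u - 1) v,
    refHat_swap (u + 1) v, refHat_swap (u - 1) (v - 1), refHat_swap (u + 1) (v + 1)]
  ring

lemma starSum_neg (u v : ℝ) : starSum (-u) (-v) = starSum u v := by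
  unfold starSum
  rw [show -u - 1 = -(u + 1) by ring, show -u + 1 = -(u - 1) by ring,
    show -v - 1 = -(v + 1) by ring, show -v + 1 = -(v - 1) by ring]
  simp only [refHat_neg]
  ring

lemma starSum_of_nonneg_of_le {u v : ℝ} (hv : 0 ≤ v) (hvu : v ≤ u) (hu : u ≤ 1) :
    starSum u v = 1 := by
  have right : refHat (u - 1) v = u - v := by
    rw [← refHat_swap, refHat_of_nonneg_of_nonpos hv (by linarith) (by linarith)]
    ring
  have diag : refHat (u - 1) (v - 1) = v := by
    rw [← refHat_neg, ← refHat_swap,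
      refHat_of_nonneg_of_le (by linarith) (by linarith) (by linarith)]
    ring
  have left : refHat (u + 1) v = 0 :=
    refHat_eq_zero (.inl (le_abs.2 (.inl (by linarith))))
  have up : refHat u (v - 1) = 0 :=
    refHat_eq_zero (.inr (.inr (le_abs.2 (.inl (by linarith)))))
  have down : refHat u (v + 1) = 0 :=
    refHat_eq_zero (.inr (.inl (le_abs.2 (.inl (by linarith)))))
  have antidiag : refHat (u + 1) (v + 1) = 0 :=
    refHat_eq_zero (.inl (le_abs.2 (.inl (by linarith))))
  rw [starSum, refHat_of_nonneg_of_le hv hvu hu, right, diag, left, up, down, antidiag]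
  ring

lemma starSum_of_nonneg_of_nonpos {u v : ℝ} (hu : 0 ≤ u) (hv : v ≤ 0) (huv : u - v ≤ 1) :
    starSum u v = 1 := by
  have right : refHat (u - 1) v = u := by
    rw [← refHat_neg, refHat_of_nonneg_of_le (by linarith) (by linarith) (by linarith)]
    ring
  have down : refHat u (v + 1) = -v := by
    rw [← refHat_swap, refHat_of_nonneg_of_le hu (by linarith) (by linarith)]
    ring
  have left : refHat (u + 1) v = 0 :=
    refHat_eq_zero (.inl (le_abs.2 (.inl (by linarith))))
  have up : refHat u (v - 1) = 0 :=
    refHat_eq_zero (.inr (.inl (le_abs.2 (.inr (by linarith)))))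
  have diag : refHat (u - 1) (v - 1) = 0 :=
    refHat_eq_zero (.inr (.inl (le_abs.2 (.inr (by linarith)))))
  have antidiag : refHat (u + 1) (v + 1) = 0 :=
    refHat_eq_zero (.inl (le_abs.2 (.inl (by linarith))))
  rw [starSum, refHat_of_nonneg_of_nonpos hu hv huv, right, diag, left, up, down, antidiag]
  ring

lemma starSum_eq_one {u v : ℝ} (hpos : refHat u v ≠ 0) : starSum u v = 1 := by
  have H : ¬(1 ≤ |u| ∨ 1 ≤ |v| ∨ 1 ≤ |u - v|) := fun H => hpos (refHat_eq_zero H)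
  push Not at H
  obtain ⟨hu, hv, huv⟩ := H
  rw [abs_lt] at hu hv huv
  rcases le_total 0 u with h0u | h0u <;> rcases le_total 0 v with h0v | h0v
  · rcases le_total v u with hle | hle
    · exact starSum_of_nonneg_of_le h0v hle hu.2.le
    · rw [← starSum_swap]
      exact starSum_of_nonneg_of_le h0u hle hv.2.le
  · exact starSum_of_nonneg_of_nonpos h0u h0v huv.2.le
  · rw [← starSum_swap]
    exact starSum_of_nonneg_of_nonpos h0v h0u (by linarith)
  · rw [← starSum_neg]
    rcases le_total v u with hle | hle
    · rw [← starSum_swap]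
      exact starSum_of_nonneg_of_le (by linarith) (by linarith) (by linarith)
    · exact starSum_of_nonneg_of_le (by linarith) (by linarith) (by linarith)

/-- A node together with its six neighbours. -/
def nodeStar (p : ℤ × ℤ) : Option (Fin 3 × Bool) → ℤ × ℤ
  | none => p
  | some (s, true) => dp s p
  | some (s, false) => dm s p

lemma sum_star (F : ℤ × ℤ → ℝ) (p : ℤ × ℤ) :
    ∑ k, F (nodeStar p k) = F p + ∑ s : Fin 3, (F (dp s p) + F (dm s p)) := by
  simp [Fintype.sum_option, Fintype.sum_prod_type, nodeStar]

lemma sum_hat_star {h : ℝ} {p : ℤ × ℤ} {x : ℝ × ℝ} (hx : hat h p x ≠ 0) :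
    ∑ k, hat h (nodeStar p k) x = 1 := by
  rw [sum_star (fun r => hat h r x)]
  simp only [hat_eq_refHat] at hx ⊢
  rw [← starSum_eq_one hx, starSum, Fin.sum_univ_three]
  simp only [dp, dm, Fin.isValue, if_true, one_ne_zero, if_false, Fin.reduceEq]
  push_cast
  simp only [← sub_sub, sub_add]
  ring_nf

lemma hat_nonneg (h : ℝ) (p : ℤ × ℤ) (x : ℝ × ℝ) : 0 ≤ hat h p x := le_max_left _ _

lemma hat_le_one (h : ℝ) (p : ℤ × ℤ) (x : ℝ × ℝ) : hat h p x ≤ 1 :=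
  max_le zero_le_one (sub_le_self _ ((abs_nonneg _).trans (le_max_left _ _)))

lemma continuous_hat (h : ℝ) (p : ℤ × ℤ) : Continuous (hat h p) := by
  unfold hat
  fun_prop

lemma exists_lipschitzWith_hat (h : ℝ) (p : ℤ × ℤ) : ∃ C, LipschitzWith C (hat h p) := by
  have lip_abs : LipschitzWith 1 (fun t : ℝ => |t|) := lipschitzWith_one_norm
  have lip_affine (L : ℝ × ℝ →L[ℝ] ℝ) (c : ℝ) :
      LipschitzWith (1 * (‖L‖₊ + 0)) (fun x => |L x - c|) :=
    lip_abs.comp (L.lipschitz.sub (LipschitzWith.const c))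
  have lip_max := (lip_affine (h⁻¹ • ContinuousLinearMap.fst ℝ ℝ ℝ) p.1).max
    ((lip_affine (h⁻¹ • ContinuousLinearMap.snd ℝ ℝ ℝ) p.2).max
      (lip_affine (h⁻¹ • (ContinuousLinearMap.fst ℝ ℝ ℝ - ContinuousLinearMap.snd ℝ ℝ ℝ))
        (p.1 - p.2)))
  have lip_hat := ((LipschitzWith.const (1 : ℝ)).sub lip_max).const_max 0
  refine Exists.intro _ (fun x y => le_trans (le_of_eq ?_) (lip_hat x y))
  simp [hat, div_eq_inv_mul]

lemma sum_gradDot_hat_star {h : ℝ} {p : ℤ × ℤ} {x : ℝ × ℝ}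
    (hd : ∀ k, DifferentiableAt ℝ (hat h (nodeStar p k)) x) :
    ∑ k, gradDot (hat h p) (hat h (nodeStar p k)) x = 0 := by
  by_cases hx : hat h p x = 0
  · have hmin : IsLocalMin (hat h p) x :=
      Filter.Eventually.of_forall fun y => hx ▸ hat_nonneg h p y
    simp [gradDot, hmin.fderiv_eq_zero]
  · have hloc : (fun y => ∑ k, hat h (nodeStar p k) y) =ᶠ[nhds x] fun _ => 1 :=
      ((continuous_hat h p).continuousAt.eventually_ne hx).mono fun y hy => sum_hat_star hy
    have hsum : ∑ k, fderiv ℝ (hat h (nodeStar p k)) x = 0 := by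
      rw [← fderiv_fun_sum fun k _ => hd k, hloc.fderiv_eq, fderiv_fun_const, Pi.zero_apply]
    simp only [gradDot, Finset.sum_add_distrib, ← Finset.mul_sum,
      ← sum_apply, hsum, zero_apply, mul_zero, add_zero]

lemma ae_differentiableAt_hat (h : ℝ) (p : ℤ × ℤ) :
    ∀ᵐ x, DifferentiableAt ℝ (hat h p) x :=
  (exists_lipschitzWith_hat h p).choose_spec.ae_differentiableAt

lemma integrableOn_gradDot_hat (h : ℝ) (p r : ℤ × ℤ) {s : Set (ℝ × ℝ)} (hs : volume s ≠ ⊤) :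
    IntegrableOn (gradDot (hat h p) (hat h r)) s := by
  have meas (q : ℤ × ℤ) (v : ℝ × ℝ) : Measurable fun x => fderiv ℝ (hat h q) x v :=
    measurable_fderiv_apply_const ℝ _ v
  have bdd (q : ℤ × ℤ) (v : ℝ × ℝ) : ∃ C, ∀ x, ‖fderiv ℝ (hat h q) x v‖ ≤ C := by
    obtain ⟨C, hC⟩ := exists_lipschitzWith_hat h q
    exact ⟨C * ‖v‖, fun x => (fderiv ℝ (hat h q) x).le_of_opNorm_le
      (norm_fderiv_le_of_lipschitz ℝ hC) v⟩
  have int (v : ℝ × ℝ) :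
      IntegrableOn (fun x => fderiv ℝ (hat h p) x v * fderiv ℝ (hat h r) x v) s := by
    obtain ⟨C, hC⟩ := bdd p v
    obtain ⟨D, hD⟩ := bdd r v
    refine Measure.integrableOn_of_bounded hs
      ((meas p v).mul (meas r v)).aestronglyMeasurable (M := C * D) (.of_forall fun x => ?_)
    rw [norm_mul]
    exact mul_le_mul (hC x) (hD x) (norm_nonneg _) ((norm_nonneg _).trans (hC x))
  exact (int (1, 0)).add (int (0, 1))

lemma integrableOn_mul_hat {Q : ℝ × ℝ → ℝ} {s : Set (ℝ × ℝ)} (hQ : IntegrableOn Q s)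
    (h : ℝ) (p : ℤ × ℤ) : IntegrableOn (fun x => Q x * hat h p x) s :=
  Integrable.mul_bdd hQ (c := 1) (continuous_hat h p).aestronglyMeasurable
    (.of_forall fun x => by
      rw [Real.norm_of_nonneg (hat_nonneg h p x)]
      exact hat_le_one h p x)

lemma tri_subset {N : ℕ} {h : ℝ} (hh : h = 1 / N) (a b : Fin N) (c : Bool) :
    tri h a b c ⊆ Set.Icc 0 1 ×ˢ Set.Icc 0 1 := by
  have hN : (0 : ℝ) < N := by exact_mod_cast a.pos
  have h0 : 0 ≤ h := by rw [hh]; positivity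
  have node (n : ℕ) (hn : n ≤ N) : (n : ℝ) * h ∈ Set.Icc (0 : ℝ) 1 := by
    refine ⟨by positivity, ?_⟩
    rw [hh, mul_one_div, div_le_one hN]
    exact_mod_cast hn
  have ha := node a a.2.le
  have hb := node b b.2.le
  have ha' := node (a + 1) a.2
  have hb' := node (b + 1) b.2
  push_cast at ha' hb'
  have hconv : Convex ℝ (Set.Icc (0 : ℝ) 1 ×ˢ Set.Icc (0 : ℝ) 1) :=
    (convex_Icc 0 1).prod (convex_Icc 0 1)
  cases c
  · refine convexHull_min ?_ hconv
    rintro x (rfl | rfl | rfl)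
    exacts [⟨ha, hb⟩, ⟨ha, hb'⟩, ⟨ha', hb'⟩]
  · refine convexHull_min ?_ hconv
    rintro x (rfl | rfl | rfl)
    exacts [⟨ha, hb⟩, ⟨ha', hb⟩, ⟨ha', hb'⟩]

lemma convex_tri (h : ℝ) (a b : ℕ) (c : Bool) : Convex ℝ (tri h a b c) := by
  cases c <;> exact convex_convexHull ℝ _

lemma isCompact_tri (h : ℝ) (a b : ℕ) (c : Bool) : IsCompact (tri h a b c) := by
  cases c <;> exact (Set.toFinite _).isCompact_convexHull ℝ

lemma bary_mem_tri (h : ℝ) (a b : ℕ) (c : Bool) : bary h a b c ∈ tri h a b c := by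
  have comb {x y z w : ℝ × ℝ} (hw : w = (1 / 3 : ℝ) • x + (1 / 3 : ℝ) • y + (1 / 3 : ℝ) • z) :
      w ∈ convexHull ℝ {x, y, z} := by
    exact mem_convexHull_of_exists_fintype (R := ℝ) (s := {x, y, z}) (x := w)
      (fun _ : Fin 3 => 1 / 3) ![x, y, z] (fun _ => by norm_num) (by norm_num)
      (fun k => by fin_cases k <;> simp) (by rw [Fin.sum_univ_three, hw]; rfl)
  cases c
  · refine comb ?_
    ext <;> simp [bary] <;> ring
  · refine comb ?_
    ext <;> simp [bary] <;> ring

lemma patch_subset_tri {h δ : ℝ} (hδ0 : 0 < δ) (hδh : δ ≤ h) (a b : ℕ) (c : Bool) :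
    patch h δ a b c ⊆ tri h a b c := by
  rintro _ ⟨x, hx, rfl⟩
  rw [AffineMap.homothety_eq_lineMap]
  exact (convex_tri h a b c).lineMap_mem (bary_mem_tri h a b c) hx
    ⟨by have := hδ0.trans_le hδh; positivity, div_le_one_of_le₀ hδh (hδ0.le.trans hδh)⟩

lemma isCompact_patch (h δ : ℝ) (a b : ℕ) (c : Bool) : IsCompact (patch h δ a b c) :=
  (isCompact_tri h a b c).image (AffineMap.homothety_continuous _ _)

lemma integrableOn_patch {N : ℕ} {h δ : ℝ} (hh : h = 1 / N) (hδ0 : 0 < δ) (hδh : δ ≤ h)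
    {Q : ℝ × ℝ → ℝ} (hQ : IntegrableOn Q Ysq) (a b : Fin N) (c : Bool) :
    IntegrableOn Q (patch h δ a b c) := by
  have hae : Ysq =ᵐ[volume] Set.Icc (0 : ℝ) 1 ×ˢ Set.Icc (0 : ℝ) 1 := by
    rw [Measure.volume_eq_prod]
    exact Measure.set_prod_ae_eq Ioo_ae_eq_Icc Ioo_ae_eq_Icc
  exact (hQ.congr_set_ae hae.symm).mono_set
    ((patch_subset_tri hδ0 hδh a b c).trans (tri_subset hh a b c))

lemma sum_stiff_star {N : ℕ} {h δ : ℝ} (hh : h = 1 / N) (hδ0 : 0 < δ) (hδh : δ ≤ h)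
    {Q : ℝ × ℝ → ℝ} (hQ : IntegrableOn Q Ysq) (p : ℤ × ℤ) :
    ∑ k, stiff h δ N Q p (nodeStar p k) = dQvec h δ N Q p := by
  unfold stiff dQvec
  rw [Finset.sum_comm]
  refine Finset.sum_congr rfl fun t _ => ?_
  have hQt := integrableOn_patch hh hδ0 hδh hQ t.1 t.2.1 t.2.2
  have hfin : volume (patch h δ t.1 t.2.1 t.2.2) ≠ ⊤ :=
    (isCompact_patch h δ t.1 t.2.1 t.2.2).measure_lt_top.ne
  have hint (r : ℤ × ℤ) :
      IntegrableOn (fun x => gradDot (hat h p) (hat h r) x + Q x * hat h p x * hat h r x)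
        (patch h δ t.1 t.2.1 t.2.2) :=
    (integrableOn_gradDot_hat h p r hfin).add
      (integrableOn_mul_hat (integrableOn_mul_hat hQt h p) h r)
  rw [← Finset.mul_sum, ← integral_finsetSum _ fun k _ => hint (nodeStar p k)]
  congr 1
  refine integral_congr_ae (ae_restrict_of_ae ?_)
  filter_upwards [ae_all_iff.2 fun k => ae_differentiableAt_hat h (nodeStar p k)] with x hx
  rw [Finset.sum_add_distrib, sum_gradDot_hat_star hx, zero_add, ← Finset.mul_sum]
  by_cases h0 : hat h p x = 0
  · simp [h0]
  · rw [sum_hat_star h0, mul_one]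

/-- Conservative structure (P3) of the HMM stiffness matrix: for any
integrable potential `Q` and any interior node `ij`,
`A^Q_{ij,ij} = d^Q_{ij} − Σ_{s=1}^{3} (A^Q_{ij,d^+_s ij} + A^Q_{ij,d^-_s ij})`. -/
theorem stmt10 (N : ℕ) (hN : 0 < N) (h δ : ℝ) (hh : h = 1 / N)
    (hδ0 : 0 < δ) (hδh : δ ≤ h)
    (Q : ℝ × ℝ → ℝ) (hQ : IntegrableOn Q Ysq)
    (i j : ℤ) (hi : 1 ≤ i ∧ i ≤ (N : ℤ) - 1) (hj : 1 ≤ j ∧ j ≤ (N : ℤ) - 1) :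
    stiff h δ N Q (i, j) (i, j) =
      dQvec h δ N Q (i, j) -
        ∑ s : Fin 3, (stiff h δ N Q (i, j) (dp s (i, j)) + stiff h δ N Q (i, j) (dm s (i, j))) := by
  have key := sum_stiff_star hh hδ0 hδh hQ (i, j)
  rw [sum_star] at key
  linarith
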